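/- (Lemma 6.6, point-evaluation encoder for analytic data) Let d ∈ {2,3}, let Ω ⊂ ℝ^d be a bounded open set whose closure admits a regular simplicial triangulation, and let B > 0. Then there exists C > 0 such that for every ε ∈ (0,1) there exist M ∈ ℕ with M ≤ C(1 + |log ε|^d), points x₁, …, x_M ∈ Ω, and functions ξ₁, …, ξ_M ∈ L^∞(Ω) such that sup_{a ∈ A(Ω̄;B)} ‖a − Σ_{k=1}^M a(x_k) ξ_k‖_{L^∞(Ω)} ≤ ε. -/

import Mathlib

/-- Iterated partial derivative `∂^ν v` of `v : ℝ^d → ℝ`, encoded by a list of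
coordinate directions. -/
noncomputable def partialDeriv {d : ℕ} (v : EuclideanSpace ℝ (Fin d) → ℝ) :
    List (Fin d) → EuclideanSpace ℝ (Fin d) → ℝ
  | [] => v
  | i :: l => fun x => fderiv ℝ (partialDeriv v l) x (EuclideanSpace.single i 1)

/-- The class `A(Ω̄; B)` of functions analytic near `Ω̄` with
`|∂^ν v| ≤ B^{|ν|+1} |ν|!` on `Ω` for all multi-indices `ν`. -/
def AnalClass {d : ℕ} (Ω : Set (EuclideanSpace ℝ (Fin d))) (B : ℝ) :
    Set (EuclideanSpace ℝ (Fin d) → ℝ) :=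
  {v | (∃ U, IsOpen U ∧ closure Ω ⊆ U ∧ ContDiffOn ℝ (⊤ : ℕ∞) v U) ∧
    ∀ l : List (Fin d), ∀ x ∈ Ω,
      |partialDeriv v l x| ≤ B ^ (l.length + 1) * (Nat.factorial l.length : ℝ)}

/-- `Ω̄` is the union of finitely many nondegenerate closed `d`-simplices, any
two of which intersect in the convex hull of a common set of vertices (a regular
simplicial triangulation of `Ω̄`). -/
def HasRegularTriangulation {d : ℕ} (Ω : Set (EuclideanSpace ℝ (Fin d))) : Prop :=
  ∃ (n : ℕ) (v : Fin n → Fin (d + 1) → EuclideanSpace ℝ (Fin d)),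
    (∀ i, AffineIndependent ℝ (v i)) ∧
    closure Ω = ⋃ i, convexHull ℝ (Set.range (v i)) ∧
    ∀ i j, ∃ s : Set (EuclideanSpace ℝ (Fin d)),
      s ⊆ Set.range (v i) ∧ s ⊆ Set.range (v j) ∧
      convexHull ℝ (Set.range (v i)) ∩ convexHull ℝ (Set.range (v j)) =
        convexHull ℝ s

/-- A bounded finite family of functions on `X` is reproduced from its values at finitely many points
of `X` by functions that are at most `2` in absolute value. -/
theorem exists_sampling_points {E ι : Type*} [Fintype ι] (X : Set E) (φ : E → ι → ℝ) (R : ℝ)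
    (hR : ∀ x ∈ X, ∀ i, |φ x i| ≤ R) :
    ∃ n ≤ Fintype.card ι, ∃ (p : Fin n → E) (ℓ : Fin n → E → ℝ),
      (∀ k, p k ∈ X) ∧ (∀ k, ∀ x ∈ X, |ℓ k x| ≤ 2) ∧
      ∀ x ∈ X, ∀ i, φ x i = ∑ k, ℓ k x * φ (p k) i := by
  classical
  obtain ⟨f, hfX, hfs, hfli⟩ := Submodule.exists_fun_fin_finrank_span_eq ℝ (φ '' X)
  have hn : Module.finrank ℝ (Submodule.span ℝ (φ '' X)) ≤ Fintype.card ι := by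
    simpa using Submodule.finrank_le (Submodule.span ℝ (φ '' X))
  generalize Module.finrank ℝ (Submodule.span ℝ (φ '' X)) = n at f hfX hfs hfli hn
  refine ⟨n, hn, ?_⟩
  choose q hqX hq using hfX
  let e : Module.Basis (Fin n) ℝ (Submodule.span ℝ (Set.range f)) := Module.Basis.span hfli
  have hmem : ∀ x : X, φ x ∈ Submodule.span ℝ (Set.range f) := fun x => by
    rw [hfs]; exact Submodule.subset_span ⟨x, x.2, rfl⟩
  let ψ : X → Submodule.span ℝ (Set.range f) := fun x => ⟨φ x, hmem x⟩
  let L := LinearMap.toContinuousLinearMap e.equivFun.toLinearMap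
  have hL : ∀ (x : X) (i : Fin n), |e.repr (ψ x) i| ≤ ‖L‖ * |R| := by
    intro x i
    calc |e.repr (ψ x) i| = ‖L (ψ x) i‖ := by simp [L]
      _ ≤ ‖L (ψ x)‖ := norm_le_pi_norm _ _
      _ ≤ ‖L‖ * ‖ψ x‖ := L.le_opNorm _
      _ ≤ ‖L‖ * |R| := by
        gcongr
        change ‖φ x‖ ≤ _
        rw [pi_norm_le_iff_of_nonneg (abs_nonneg R)]
        exact fun i => (hR x x.2 i).trans (le_abs_self R)
  let D : (Fin n → X) → ℝ := fun v => |e.det (fun k => ψ (v k))|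
  have hbdd : BddAbove (Set.range D) := by
    refine ⟨(Fintype.card (Fin n)).factorial • (‖L‖ * |R|) ^ Fintype.card (Fin n), ?_⟩
    rintro _ ⟨v, rfl⟩
    exact Matrix.det_le (A := e.toMatrix (fun k => ψ (v k))) (abv := AbsoluteValue.abs)
      (fun i j => hL (v j) i)
  have hpos : 0 < ⨆ v, D v := by
    have h1 : D (fun k => ⟨q k, hqX k⟩) = 1 := by
      have : (fun k => ψ ⟨q k, hqX k⟩) = e := by
        funext k
        apply Subtype.ext
        rw [Module.Basis.span_apply]
        exact hq k
      simp [D, this, Module.Basis.det_self]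
    exact lt_of_lt_of_le (by rw [h1]; exact one_pos) (le_ciSup hbdd (fun k => ⟨q k, hqX k⟩))
  have : Nonempty (Fin n → X) := ⟨fun k => ⟨q k, hqX k⟩⟩
  obtain ⟨v, hv⟩ := exists_lt_of_lt_ciSup (half_lt_self hpos)
  have hv0 : 0 < |e.det (fun k => ψ (v k))| := (half_pos hpos).trans hv
  obtain ⟨hli, hsp⟩ := (Module.Basis.is_basis_iff_det e (v := fun k => ψ (v k))).2
    (isUnit_iff_ne_zero.2 (abs_pos.1 hv0))
  let b := Module.Basis.mk hli hsp.ge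
  refine ⟨fun k => v k, fun k x => if h : x ∈ X then b.repr (ψ ⟨x, h⟩) k else 0,
    fun k => (v k).2, ?_, ?_⟩
  · intro k x hx
    simp only [hx, dif_pos]
    have h1 := LinearMap.congr_fun (e.det_smul_mk_coord_eq_det_update hli hsp.ge k) (ψ ⟨x, hx⟩)
    have h2 : |e.det (fun k => ψ (v k))| * |b.repr (ψ ⟨x, hx⟩) k| ≤ ⨆ v, D v := by
      rw [← abs_mul]
      have h3 : e.det (fun k => ψ (v k)) * b.repr (ψ ⟨x, hx⟩) k =
          e.det (fun j => ψ (Function.update v k ⟨x, hx⟩ j)) := by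
        refine h1.trans ?_
        change e.det (Function.update (fun k => ψ (v k)) k (ψ ⟨x, hx⟩)) = _
        congr 1
        exact (Function.comp_update ψ v k ⟨x, hx⟩).symm
      rw [h3]
      exact le_ciSup hbdd (Function.update v k ⟨x, hx⟩)
    have hv' : (⨆ v, D v) / 2 < |e.det (fun k => ψ (v k))| := hv
    by_contra! hc
    nlinarith
  · intro x hx i
    simp only [hx, dif_pos]
    have := congrArg (fun w : Submodule.span ℝ (Set.range f) => (w : ι → ℝ) i)
      (b.sum_repr (ψ ⟨x, hx⟩))
    simpa [b, ψ] using this.symm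

/-- Taylor's theorem on `[0, 1]` for a sequence of successive derivatives. -/
theorem abs_sub_taylor_le {M : ℝ} (n : ℕ) (g : ℕ → ℝ → ℝ)
    (hg : ∀ k, ∀ t ∈ Set.Icc (0 : ℝ) 1, HasDerivAt (g k) (g (k + 1) t) t)
    (hM : ∀ t ∈ Set.Icc (0 : ℝ) 1, |g n t| ≤ M) :
    ∀ t ∈ Set.Icc (0 : ℝ) 1,
      |g 0 t - ∑ k ∈ Finset.range n, g k 0 * (t ^ k / k.factorial)| ≤
        M * (t ^ n / n.factorial) := by
  induction n generalizing g with
  | zero => simpa using hM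
  | succ n ih =>
    have hmon : ∀ (k : ℕ) (t : ℝ), HasDerivAt (fun t : ℝ => t ^ (k + 1) / (k + 1).factorial)
        (t ^ k / k.factorial) t := by
      intro k t
      convert! (hasDerivAt_pow (k + 1) t).div_const ((k + 1).factorial : ℝ) using 1
      rw [Nat.factorial_succ]
      push_cast
      field_simp
    have ih' := ih (fun k => g (k + 1)) (fun k => hg (k + 1)) hM
    have hder : ∀ t ∈ Set.Icc (0 : ℝ) 1, HasDerivAt
        (fun t => g 0 t - ∑ k ∈ Finset.range (n + 1), g k 0 * (t ^ k / k.factorial))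
        (g 1 t - ∑ k ∈ Finset.range n, g (k + 1) 0 * (t ^ k / k.factorial)) t := by
      intro t ht
      refine (hg 0 t ht).sub ?_
      simp only [Finset.sum_range_succ']
      simp only [pow_zero]
      refine HasDerivAt.add_const _ ?_
      exact HasDerivAt.fun_sum fun k _ => (hmon k t).const_mul _
    intro t ht
    refine image_norm_le_of_norm_deriv_right_le_deriv_boundary
      (f' := fun t => g 1 t - ∑ k ∈ Finset.range n, g (k + 1) 0 * (t ^ k / k.factorial))
      (fun s hs => (hder s hs).continuousAt.continuousWithinAt)
      (fun s hs => (hder s (Set.Ico_subset_Icc_self hs)).hasDerivWithinAt)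
      ?_ (fun s => (hmon n s).const_mul M)
      (fun s hs => ih' s (Set.Ico_subset_Icc_self hs)) ht
    simp [Finset.sum_range_succ']

theorem contDiffOn_partialDeriv {d : ℕ} {v : EuclideanSpace ℝ (Fin d) → ℝ}
    {U : Set (EuclideanSpace ℝ (Fin d))} (hU : IsOpen U) (hv : ContDiffOn ℝ (⊤ : ℕ∞) v U)
    (l : List (Fin d)) : ContDiffOn ℝ (⊤ : ℕ∞) (partialDeriv v l) U := by
  induction l with
  | nil => exact hv
  | cons i l ih => exact (ih.fderiv_of_isOpen hU (by simp)).clm_apply contDiffOn_const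

theorem abs_partialDeriv_le_of_mem_closure {d : ℕ} {Ω : Set (EuclideanSpace ℝ (Fin d))} {B : ℝ}
    {a : EuclideanSpace ℝ (Fin d) → ℝ} (ha : a ∈ AnalClass Ω B) (l : List (Fin d))
    {x : EuclideanSpace ℝ (Fin d)} (hx : x ∈ closure Ω) :
    |partialDeriv a l x| ≤ B ^ (l.length + 1) * (Nat.factorial l.length : ℝ) := by
  obtain ⟨⟨U, hU, hΩU, hsm⟩, hb⟩ := ha
  exact le_on_closure (f := fun x => |partialDeriv a l x|) (hb l)
    ((contDiffOn_partialDeriv hU hsm l).continuousOn.mono hΩU).abs continuousOn_const hx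

/-- The `k`-th derivative of `v` along the direction `w`, in coordinates. -/
noncomputable def directionalDeriv {d : ℕ} (v : EuclideanSpace ℝ (Fin d) → ℝ)
    (w : EuclideanSpace ℝ (Fin d)) (k : ℕ) (y : EuclideanSpace ℝ (Fin d)) : ℝ :=
  ∑ l : Fin k → Fin d, (∏ i, w (l i)) * partialDeriv v (List.ofFn l) y

theorem hasDerivAt_directionalDeriv {d : ℕ} {v : EuclideanSpace ℝ (Fin d) → ℝ}
    {U : Set (EuclideanSpace ℝ (Fin d))} (hU : IsOpen U) (hv : ContDiffOn ℝ (⊤ : ℕ∞) v U)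
    (y w : EuclideanSpace ℝ (Fin d)) (k : ℕ) (t : ℝ) (ht : y + t • w ∈ U) :
    HasDerivAt (fun t : ℝ => directionalDeriv v w k (y + t • w))
      (directionalDeriv v w (k + 1) (y + t • w)) t := by
  have hline : HasDerivAt (fun t : ℝ => y + t • w) w t := by
    simpa using ((hasDerivAt_id t).smul_const w).const_add y
  have hw : w = ∑ j, w j • EuclideanSpace.single j (1 : ℝ) := by
    ext i; simp [Pi.single_apply]
  have key : ∀ l : List (Fin d), HasDerivAt (fun t : ℝ => partialDeriv v l (y + t • w))
      (∑ j, w j * partialDeriv v (j :: l) (y + t • w)) t := by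
    intro l
    have h1 := ((contDiffOn_partialDeriv hU hv l).differentiableOn (by simp)).differentiableAt
      (hU.mem_nhds ht)
    convert! h1.hasFDerivAt.comp_hasDerivAt t hline using 1
    conv_rhs => arg 2; rw [hw]
    simp [partialDeriv]
  have hsum : directionalDeriv v w (k + 1) (y + t • w) =
      ∑ l : Fin k → Fin d, (∏ i, w (l i)) *
        ∑ j, w j * partialDeriv v (j :: List.ofFn l) (y + t • w) := by
    rw [directionalDeriv, ← (Fin.consEquiv (fun _ => Fin d)).sum_comp, Fintype.sum_prod_type_right]
    refine Finset.sum_congr rfl fun l _ => ?_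
    rw [Finset.mul_sum]
    refine Finset.sum_congr rfl fun j _ => ?_
    simp [Fin.prod_univ_succ, List.ofFn_succ, Fin.consEquiv]
    ring
  rw [hsum]
  exact HasDerivAt.fun_sum fun l _ => (key (List.ofFn l)).const_mul _

theorem abs_directionalDeriv_le {d : ℕ} {v : EuclideanSpace ℝ (Fin d) → ℝ}
    {w y : EuclideanSpace ℝ (Fin d)} {k : ℕ} {δ A : ℝ} (hw : ‖w‖ ≤ δ)
    (hA : ∀ l : Fin k → Fin d, |partialDeriv v (List.ofFn l) y| ≤ A) :
    |directionalDeriv v w k y| ≤ (d * δ) ^ k * A := by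
  have hwi : ∀ i, |w i| ≤ δ := fun i => (PiLp.norm_apply_le w i).trans hw
  have hδ : 0 ≤ δ := (norm_nonneg w).trans hw
  calc |directionalDeriv v w k y|
      ≤ ∑ l : Fin k → Fin d, |(∏ i, w (l i)) * partialDeriv v (List.ofFn l) y| :=
        Finset.abs_sum_le_sum_abs _ _
    _ ≤ ∑ _l : Fin k → Fin d, δ ^ k * A := by
        refine Finset.sum_le_sum fun l _ => ?_
        rw [abs_mul]
        refine mul_le_mul ?_ (hA l) (abs_nonneg _) (by positivity)
        rw [Finset.abs_prod]
        calc ∏ i, |w (l i)| ≤ ∏ _i : Fin k, δ :=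
              Finset.prod_le_prod (fun _ _ => abs_nonneg _) fun i _ => hwi _
          _ = δ ^ k := by simp
    _ = (d * δ) ^ k * A := by
        simp [mul_pow]; ring

/-- On a convex piece of the closure of small diameter, sampling at `N ^ d` points of `Ω` is
exponentially accurate on the analytic class. -/
theorem exists_local_encoder {d : ℕ} {Ω K : Set (EuclideanSpace ℝ (Fin d))} {B δ : ℝ} (hB : 0 < B)
    (hK : Convex ℝ K) (hKΩ : K ⊆ closure Ω) (hδ : ∀ x ∈ K, ∀ y ∈ K, ‖x - y‖ ≤ δ)
    (hq : d * δ * B ≤ 1 / 4) (N : ℕ) :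
    ∃ n ≤ N ^ d, ∃ (p : Fin n → EuclideanSpace ℝ (Fin d))
      (ℓ : Fin n → EuclideanSpace ℝ (Fin d) → ℝ),
      (∀ k, p k ∈ K ∩ Ω) ∧ (∀ k, ∀ x ∈ K ∩ Ω, |ℓ k x| ≤ 2) ∧
      ∀ a ∈ AnalClass Ω B, ∀ x ∈ K ∩ Ω,
        |a x - ∑ k, a (p k) * ℓ k x| ≤ (1 + 2 * n) * (B * (1 / 4) ^ N) := by
  rcases (K ∩ Ω).eq_empty_or_nonempty with hX | ⟨x₀, hx₀⟩
  · exact ⟨0, Nat.zero_le _, Fin.elim0, Fin.elim0, by simp, by simp, by simp [hX]⟩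
  have hδ0 : 0 ≤ δ := (norm_nonneg _).trans (hδ x₀ hx₀.1 x₀ hx₀.1)
  let φ : EuclideanSpace ℝ (Fin d) → (Fin d → Fin N) → ℝ :=
    fun x ν => ∏ j, (x - x₀) j ^ (ν j : ℕ)
  obtain ⟨n, hn, p, ℓ, hp, hℓ, hrep⟩ := exists_sampling_points (K ∩ Ω) φ ((1 + δ) ^ (d * N)) (by
    intro x hx ν
    simp only [φ, Finset.abs_prod, abs_pow]
    calc ∏ j, |(x - x₀) j| ^ (ν j : ℕ) ≤ ∏ _j : Fin d, (1 + δ) ^ N := by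
          refine Finset.prod_le_prod (fun _ _ => by positivity) fun j _ => ?_
          have h1 : |(x - x₀) j| ≤ 1 + δ :=
            ((PiLp.norm_apply_le (x - x₀) j).trans (hδ x hx.1 x₀ hx₀.1)).trans (by linarith)
          calc |(x - x₀) j| ^ (ν j : ℕ) ≤ (1 + δ) ^ (ν j : ℕ) := by gcongr
            _ ≤ (1 + δ) ^ N := pow_le_pow_right₀ (by linarith) (ν j).2.le
      _ = (1 + δ) ^ (d * N) := by simp [← pow_mul, mul_comm])
  refine ⟨n, by simpa using hn, p, ℓ, hp, hℓ, ?_⟩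
  intro a ha x hx
  let P : EuclideanSpace ℝ (Fin d) → ℝ := fun x =>
    ∑ k ∈ Finset.range N, directionalDeriv a (x - x₀) k x₀ * (1 ^ k / k.factorial)
  have happrox : ∀ y ∈ K ∩ Ω, |a y - P y| ≤ B * (1 / 4) ^ N := by
    intro y hy
    have hseg : ∀ t ∈ Set.Icc (0 : ℝ) 1, x₀ + t • (y - x₀) ∈ closure Ω := fun t ht =>
      hKΩ (hK.add_smul_sub_mem hx₀.1 hy.1 ht)
    obtain ⟨U, hU, hΩU, hsm⟩ := ha.1
    have h := abs_sub_taylor_le (M := (d * δ) ^ N * (B ^ (N + 1) * N.factorial)) N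
      (fun k t => directionalDeriv a (y - x₀) k (x₀ + t • (y - x₀)))
      (fun k t ht => hasDerivAt_directionalDeriv hU hsm _ _ _ _ (hΩU (hseg t ht)))
      (fun t ht => abs_directionalDeriv_le (hδ y hy.1 x₀ hx₀.1) fun l => by
        simpa using abs_partialDeriv_le_of_mem_closure ha (List.ofFn l) (hseg t ht))
      1 (by simp)
    have h0 : directionalDeriv a (y - x₀) 0 (x₀ + (1 : ℝ) • (y - x₀)) = a y := by
      simp [directionalDeriv, partialDeriv]
    simp only [h0, zero_smul, add_zero] at h
    refine h.trans ?_
    calc (d * δ) ^ N * (B ^ (N + 1) * N.factorial) * (1 ^ N / N.factorial)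
        = B * (d * δ * B) ^ N := by
          have : (N.factorial : ℝ) ≠ 0 := by positivity
          field_simp
          ring
      _ ≤ B * (1 / 4) ^ N := by gcongr
  have hmon : ∀ k < N, ∀ l : Fin k → Fin d, ∀ y ∈ K ∩ Ω,
      ∏ i, (y - x₀) (l i) = ∑ m, ℓ m y * ∏ i, (p m - x₀) (l i) := by
    intro k hk l y hy
    let ν : Fin d → Fin N := fun j =>
      ⟨Fintype.card {i // l i = j}, (Fintype.card_subtype_le _).trans_lt (by simpa using hk)⟩
    have hν : ∀ z, φ z ν = ∏ i, (z - x₀) (l i) := fun z => by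
      rw [← Fintype.prod_fiberwise' l (fun j => (z - x₀) j)]
      simp [φ, ν]
    simpa only [hν] using hrep y hy ν
  have hP : ∀ y ∈ K ∩ Ω, P y = ∑ m, P (p m) * ℓ m y := by
    intro y hy
    have h1 : ∀ k ∈ Finset.range N, directionalDeriv a (y - x₀) k x₀ * (1 ^ k / k.factorial) =
        ∑ m, directionalDeriv a (p m - x₀) k x₀ * (1 ^ k / k.factorial) * ℓ m y := by
      intro k hk
      simp only [directionalDeriv, Finset.sum_mul]
      rw [Finset.sum_comm]
      refine Finset.sum_congr rfl fun l _ => ?_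
      rw [hmon k (Finset.mem_range.1 hk) l y hy, Finset.sum_mul, Finset.sum_mul]
      exact Finset.sum_congr rfl fun m _ => by ring
    simp only [P]
    rw [Finset.sum_congr rfl h1, Finset.sum_comm]
    simp only [Finset.sum_mul]
  have hsplit : a x - ∑ k, a (p k) * ℓ k x =
      (a x - P x) - ∑ k, (a (p k) - P (p k)) * ℓ k x := by
    simp only [sub_mul, Finset.sum_sub_distrib]
    rw [hP x hx]; ring
  rw [hsplit]
  have hsum : |∑ k, (a (p k) - P (p k)) * ℓ k x| ≤ n * (B * (1 / 4) ^ N * 2) := by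
    refine (Finset.abs_sum_le_sum_abs _ _).trans ?_
    refine (Finset.sum_le_card_nsmul _ _ (B * (1 / 4) ^ N * 2) fun k _ => ?_).trans (by simp)
    rw [abs_mul]
    exact mul_le_mul (happrox _ (hp k)) (hℓ k x hx) (abs_nonneg _) (by positivity)
  calc _ ≤ |a x - P x| + |∑ k, (a (p k) - P (p k)) * ℓ k x| := abs_sub _ _
    _ ≤ B * (1 / 4) ^ N + n * (B * (1 / 4) ^ N * 2) := add_le_add (happrox x hx) hsum
    _ = _ := by ring

theorem exists_pow_mul_half_pow_le (d : ℕ) :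
    ∃ A : ℝ, 0 < A ∧ ∀ N : ℕ, (N : ℝ) ^ d * (1 / 2) ^ N ≤ A := by
  obtain ⟨A, hA⟩ := (tendsto_pow_const_mul_const_pow_of_abs_lt_one d
    (show |(1 / 2 : ℝ)| < 1 by norm_num [abs_of_pos])).bddAbove_range
  exact ⟨max A 1, by positivity, fun N => (hA ⟨N, rfl⟩).trans (le_max_left _ _)⟩

/-- A degree of order `1 + |log ε|` makes the local sampling error at most `ε`. -/
theorem exists_degree (d : ℕ) {B : ℝ} (hB : 0 < B) : ∃ C : ℝ, 0 < C ∧ ∀ ε : ℝ, 0 < ε →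
    ∃ N : ℕ, (N : ℝ) ^ d ≤ C * (1 + |Real.log ε| ^ d) ∧
      (1 + 2 * (N : ℝ) ^ d) * (B * (1 / 4) ^ N) ≤ ε := by
  obtain ⟨A, hA, hAN⟩ := exists_pow_mul_half_pow_le d
  let A' := (1 + 2 * A) * B
  have hA' : 0 < A' := by positivity
  let c := 2 * |Real.log A'| + 2
  have hc : 2 ≤ c := by simp only [c]; linarith [abs_nonneg (Real.log A')]
  refine ⟨2 ^ (d - 1) * c ^ d, by positivity, fun ε hε => ?_⟩
  let N := ⌈2 * |Real.log A'| + 2 * |Real.log ε|⌉₊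
  refine ⟨N, ?_, ?_⟩
  · have hN : (N : ℝ) ≤ c + c * |Real.log ε| := by
      have := Nat.ceil_lt_add_one (show 0 ≤ 2 * |Real.log A'| + 2 * |Real.log ε| by positivity)
      have h2 : 2 * |Real.log ε| ≤ c * |Real.log ε| := by gcongr
      simp only [c] at *
      simp only [N]
      linarith
    calc (N : ℝ) ^ d ≤ (c + c * |Real.log ε|) ^ d := by gcongr
      _ ≤ 2 ^ (d - 1) * (c ^ d + (c * |Real.log ε|) ^ d) :=
        add_pow_le (by positivity) (by positivity) d
      _ = _ := by rw [mul_pow]; ring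
  · have h1 : (1 + 2 * (N : ℝ) ^ d) * (1 / 2) ^ N ≤ 1 + 2 * A := by
      have : (1 / 2 : ℝ) ^ N ≤ 1 := pow_le_one₀ (by norm_num) (by norm_num)
      linarith [hAN N]
    have h2 : A' ≤ ε * 2 ^ N := by
      rw [← Real.log_le_log_iff hA' (by positivity), Real.log_mul hε.ne' (by positivity),
        Real.log_pow]
      have h3 := Nat.le_ceil (2 * |Real.log A'| + 2 * |Real.log ε|)
      have h4 : (N : ℝ) * (1 / 2) ≤ N * Real.log 2 := by
        gcongr; linarith [Real.log_two_gt_d9]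
      have h5 := le_abs_self (Real.log A')
      have h6 := neg_abs_le (Real.log ε)
      simp only [N] at *
      linarith
    calc (1 + 2 * (N : ℝ) ^ d) * (B * (1 / 4) ^ N)
        = (1 + 2 * (N : ℝ) ^ d) * (1 / 2) ^ N * B * (1 / 2) ^ N := by
          rw [show (1 / 4 : ℝ) = 1 / 2 * (1 / 2) by norm_num, mul_pow]; ring
      _ ≤ (1 + 2 * A) * B * (1 / 2) ^ N := by gcongr
      _ ≤ ε * 2 ^ N * (1 / 2) ^ N := by gcongr
      _ = ε := by rw [mul_assoc, ← mul_pow]; norm_num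

/-- Lemma 6.6 (point-evaluation encoder for analytic data): there are
`M = O(|log ε|^d)` query points `x_k ∈ Ω` and bounded functions
`ξ_k ∈ L^∞(Ω)` such that `a ≈ Σ_k a(x_k) ξ_k` uniformly to accuracy `ε`
over the analytic class `A(Ω̄; B)`. -/
theorem stmt17 (d : ℕ) (hd : d = 2 ∨ d = 3)
    (Ω : Set (EuclideanSpace ℝ (Fin d))) (hΩo : IsOpen Ω)
    (hΩb : Bornology.IsBounded Ω) (hΩt : HasRegularTriangulation Ω)
    (B : ℝ) (hB : 0 < B) :
    ∃ C : ℝ, 0 < C ∧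
      ∀ ε : ℝ, 0 < ε → ε < 1 →
        ∃ (M : ℕ) (p : Fin M → EuclideanSpace ℝ (Fin d))
          (ξ : Fin M → EuclideanSpace ℝ (Fin d) → ℝ),
          (M : ℝ) ≤ C * (1 + |Real.log ε| ^ d) ∧
          (∀ k, p k ∈ Ω) ∧
          (∀ k, ∃ Ck : ℝ, ∀ x ∈ Ω, |ξ k x| ≤ Ck) ∧
          ∀ a ∈ AnalClass Ω B, ∀ x ∈ Ω,
            |a x - ∑ k, a (p k) * ξ k x| ≤ ε := by
  obtain ⟨n, v, -, hcover, -⟩ := hΩt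
  obtain ⟨δ, hδ, hq⟩ : ∃ δ : ℝ, 0 < δ ∧ d * δ * B ≤ 1 / 4 := by
    refine ⟨1 / (4 * (d + 1) * B), by positivity, ?_⟩
    rw [mul_one_div, div_mul_eq_mul_div, div_le_div_iff₀ (by positivity) (by norm_num)]
    nlinarith
  obtain ⟨T, hTfin, hT⟩ := Metric.totallyBounded_iff.1
    (hΩb.isCompact_closure.totallyBounded.subset subset_closure) (δ / 2) (by positivity)
  have := hTfin.fintype
  let J := Fin n × T
  let K : J → Set (EuclideanSpace ℝ (Fin d)) := fun j =>
    convexHull ℝ (Set.range (v j.1)) ∩ Metric.ball (j.2 : EuclideanSpace ℝ (Fin d)) (δ / 2)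
  have hmem : ∀ x ∈ Ω, ∃ j, x ∈ K j := by
    intro x hx
    obtain ⟨i, hi⟩ := Set.mem_iUnion.1 (hcover ▸ subset_closure hx)
    obtain ⟨y, hy, hxy⟩ := Set.mem_iUnion₂.1 (hT hx)
    exact ⟨(i, ⟨y, hy⟩), hi, hxy⟩
  obtain ⟨C, hC, hdeg⟩ := exists_degree d hB
  refine ⟨(Fintype.card J + 1) * C, by positivity, fun ε hε _ => ?_⟩
  obtain ⟨N, hNC, hNε⟩ := hdeg ε hε
  have hloc := fun j : J => exists_local_encoder (Ω := Ω) (K := K j) hB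
    ((convex_convexHull ℝ _).inter (convex_ball _ _))
    (fun x hx => hcover ▸ Set.mem_iUnion.2 ⟨j.1, hx.1⟩)
    (fun x hx y hy => by
      rw [← dist_eq_norm]
      linarith [dist_triangle_right x y j.2, Metric.mem_ball.1 hx.2, Metric.mem_ball.1 hy.2])
    hq N
  choose m hm p ℓ hp hℓ herr using hloc
  classical
  let e := Fintype.equivFin (Σ j : J, Fin (m j))
  let ξ : (Σ j : J, Fin (m j)) → EuclideanSpace ℝ (Fin d) → ℝ := fun s x =>
    if h : x ∈ Ω then if (hmem x h).choose = s.1 then ℓ s.1 s.2 x else 0 else 0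
  refine ⟨_, fun k => p (e.symm k).1 (e.symm k).2, fun k => ξ (e.symm k), ?_, ?_, ?_, ?_⟩
  · have hcard : Fintype.card (Σ j : J, Fin (m j)) ≤ Fintype.card J * N ^ d := by
      rw [Fintype.card_sigma]
      simpa using Finset.sum_le_card_nsmul Finset.univ m (N ^ d) fun j _ => hm j
    calc (Fintype.card (Σ j : J, Fin (m j)) : ℝ) ≤ Fintype.card J * (N : ℝ) ^ d := by
          exact_mod_cast hcard
      _ ≤ (Fintype.card J + 1) * (C * (1 + |Real.log ε| ^ d)) := by gcongr; linarith
      _ = _ := by ring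
  · exact fun k => (hp _ _).2
  · refine fun k => ⟨2, fun x hx => ?_⟩
    simp only [ξ, hx, dif_pos]
    split_ifs with h
    · exact hℓ _ _ x ⟨h ▸ (hmem x hx).choose_spec, hx⟩
    · simp
  · intro a ha x hx
    have hj := (hmem x hx).choose_spec
    have hsum : ∑ k, a (p (e.symm k).1 (e.symm k).2) * ξ (e.symm k) x =
        ∑ k, a (p (hmem x hx).choose k) * ℓ (hmem x hx).choose k x := by
      rw [e.symm.sum_comp (fun s => a (p s.1 s.2) * ξ s x), Fintype.sum_sigma,
        Finset.sum_eq_single (hmem x hx).choose]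
      · simp [ξ, hx]
      · intro j _ hne
        simp [ξ, hx, hne.symm]
      · simp
    rw [hsum]
    refine (herr _ a ha x ⟨hj, hx⟩).trans (le_trans ?_ hNε)
    gcongr
    exact_mod_cast hm _
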